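/- Let A = {a_1 < a_2 < ⋯ < a_{2k}} be a 2k-clique of 𝒢 and let w_A = $·(1 2⋯N)·#·a_1·#·(1 2⋯N)·#·a_2·#·⋯·#·a_{2k}·#·(1 2⋯N)·$. Then the string w_A·γ·w_A belongs to 𝒟₁* if and only if there exist k-cliques B and C of 𝒢 such that A, B, C are pairwise disjoint and A ∪ B ∪ C is a 4k-clique of 𝒢. -/

import Mathlib

/-- The alphabet `Σ = {1,…,N} ∪ {$, #, γ, μ, α, β}`: numeric symbols together
with six distinct special symbols. -/
inductive Letter where
  | num : ℕ → Letter
  | dollar : Letter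
  | hash : Letter
  | gam : Letter
  | mu : Letter
  | alp : Letter
  | bet : Letter
deriving DecidableEq

/-- The string of numeric symbols `a·(a+1)⋯(a+len−1)`. -/
def nums (a len : ℕ) : List Letter := (List.range len).map (fun t => Letter.num (a + t))

/-- `Low(b) = 1·2⋯(b−1)` (empty if `b = 1`). -/
def low (b : ℕ) : List Letter := nums 1 (b - 1)

/-- `High(b) = b·(b+1)⋯N`. -/
def high (N b : ℕ) : List Letter := nums b (N + 1 - b)

/-- The string `1·2⋯N`. -/
def full (N : ℕ) : List Letter := nums 1 N

/-- For a `2k`-clique `A = {a_1 < ⋯ < a_{2k}}`, the gadget string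
`w_A = $·(1 2⋯N)·#·a_1·#·(1 2⋯N)·#·a_2·#·⋯·#·a_{2k}·#·(1 2⋯N)·$`.
A vertex `a : Fin n` is written as the numeric symbol `a+1 ∈ {1,…,n}`. -/
def wordA (n N : ℕ) (A : Finset (Fin n)) : List Letter :=
  Letter.dollar :: (full N ++
    (A.sort (· ≤ ·)).flatMap (fun a => Letter.hash :: Letter.num (a.val + 1) :: Letter.hash :: full N) ++
    [Letter.dollar])

/-- `s` belongs to the Kleene star of the dictionary `D`:
`s` is a concatenation of finitely many (possibly zero) words of `D`. -/
def InStar (D : Set (List Letter)) (s : List Letter) : Prop :=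
  ∃ fs : List (List Letter), (∀ f ∈ fs, f ∈ D) ∧ fs.flatten = s

/-- The dictionary `𝒟₀`: for every `k`-clique `B` with `b = code B`,
the words `$·Low(b)` and `High(b)·$`; and for every `k`-clique `B` and every
vertex `i ∉ B` adjacent to every vertex of `B`, the word `High(b)·#·i·#·Low(b)`. -/
def dict0 (n k N : ℕ) (G : SimpleGraph (Fin n)) (code : Finset (Fin n) → ℕ) :
    Set (List Letter) :=
  {w | ∃ B : Finset (Fin n), G.IsNClique k B ∧
        (w = Letter.dollar :: low (code B) ∨
         w = high N (code B) ++ [Letter.dollar] ∨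
         ∃ i : Fin n, i ∉ B ∧ (∀ v ∈ B, G.Adj i v) ∧
           w = high N (code B) ++
               Letter.hash :: Letter.num (i.val + 1) :: Letter.hash :: low (code B))}


/-- The dictionary `𝒟₁`: `𝒟₀` together with, for every ordered pair `(B, C)` of
`k`-cliques with `B ∩ C = ∅` and every vertex of `B` adjacent to every vertex of `C`,
the word `High(code B)·$·γ·$·Low(code C)`. -/
def dict1 (n k N : ℕ) (G : SimpleGraph (Fin n)) (code : Finset (Fin n) → ℕ) :
    Set (List Letter) :=
  dict0 n k N G code ∪
    {w | ∃ B C : Finset (Fin n), G.IsNClique k B ∧ G.IsNClique k C ∧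
          Disjoint B C ∧ (∀ b ∈ B, ∀ c ∈ C, G.Adj b c) ∧
          w = high N (code B) ++
              Letter.dollar :: Letter.gam :: Letter.dollar :: low (code C)}

theorem InStar.append {D : Set (List Letter)} {w s : List Letter} (hw : w ∈ D) (hs : InStar D s) :
    InStar D (w ++ s) := by
  obtain ⟨fs, hfs, rfl⟩ := hs
  exact ⟨w :: fs, by simpa using ⟨hw, hfs⟩, by simp⟩

theorem InStar.exists_append {D : Set (List Letter)} {s : List Letter} (h : InStar D s)
    (hs : s ≠ []) : ∃ w ∈ D, ∃ t, s = w ++ t ∧ InStar D t := by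
  obtain ⟨fs, hfs, rfl⟩ := h
  cases fs with
  | nil => simp at hs
  | cons w fs =>
    simp only [List.mem_cons, forall_eq_or_imp] at hfs
    exact ⟨w, hfs.1, fs.flatten, by simp, fs, hfs.2, rfl⟩

theorem nums_append (a l m : ℕ) : nums a l ++ nums (a + l) m = nums a (l + m) := by
  simp [nums, List.range_add, Function.comp_def, Nat.add_assoc]

theorem low_append_high {N b : ℕ} (h₁ : 1 ≤ b) (h₂ : b ≤ N) : low b ++ high N b = full N := by
  have h := nums_append 1 (b - 1) (N + 1 - b)
  rw [show 1 + (b - 1) = b by omega, show b - 1 + (N + 1 - b) = N by omega] at h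
  exact h

theorem high_eq_cons {N b : ℕ} (h : b ≤ N) : high N b = Letter.num b :: nums (b + 1) (N - b) := by
  have h := nums_append b 1 (N - b)
  rw [show 1 + (N - b) = N + 1 - b by omega] at h
  rw [high, ← h]
  simp [nums]

/-- The part of `wordA` that lists the vertices of `L`, each followed by a copy of `1 2⋯N`. -/
def vertexBlocks {n : ℕ} (N : ℕ) (L : List (Fin n)) : List Letter :=
  L.flatMap (fun a => Letter.hash :: Letter.num (a.val + 1) :: Letter.hash :: full N)

section Parsing

variable {k n N : ℕ} {G : SimpleGraph (Fin n)} {code : Finset (Fin n) → ℕ}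

/-- A word of `dict1` starts either with `$` or with the code of its first clique. -/
theorem mem_dict1_cases {w : List Letter} (hw : w ∈ dict1 n k N G code) :
    ∃ B : Finset (Fin n), G.IsNClique k B ∧
      (w = Letter.dollar :: low (code B) ∨
       ∃ u, w = high N (code B) ++ u ∧
        (u = [Letter.dollar] ∨
         (∃ i : Fin n, i ∉ B ∧ (∀ v ∈ B, G.Adj i v) ∧
           u = Letter.hash :: Letter.num (i.val + 1) :: Letter.hash :: low (code B)) ∨
         ∃ C : Finset (Fin n), G.IsNClique k C ∧ Disjoint B C ∧
           (∀ b ∈ B, ∀ c ∈ C, G.Adj b c) ∧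
           u = Letter.dollar :: Letter.gam :: Letter.dollar :: low (code C))) := by
  rcases hw with ⟨B, hB, h | h | ⟨i, hi, hadj, h⟩⟩ | ⟨B, C, hB, hC, hd, hadj, h⟩
  · exact ⟨B, hB, Or.inl h⟩
  · exact ⟨B, hB, Or.inr ⟨_, h, Or.inl rfl⟩⟩
  · exact ⟨B, hB, Or.inr ⟨_, h, Or.inr (Or.inl ⟨i, hi, hadj, rfl⟩)⟩⟩
  · exact ⟨B, hB, Or.inr ⟨_, h, Or.inr (Or.inr ⟨C, hC, hd, hadj, rfl⟩)⟩⟩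

theorem inStar_dollar_full_iff
    (hrange : ∀ B : Finset (Fin n), G.IsNClique k B → 1 ≤ code B ∧ code B ≤ N)
    (R : List Letter) :
    InStar (dict1 n k N G code) (Letter.dollar :: (full N ++ R)) ↔
      ∃ B, G.IsNClique k B ∧ InStar (dict1 n k N G code) (high N (code B) ++ R) := by
  constructor
  · intro h
    obtain ⟨w, hw, t, hwt, ht⟩ := h.exists_append (by simp)
    obtain ⟨B, hB, rfl | ⟨u, rfl, -⟩⟩ := mem_dict1_cases hw
    · refine ⟨B, hB, ?_⟩
      rw [← low_append_high (hrange B hB).1 (hrange B hB).2] at hwt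
      simp only [List.cons_append, List.append_assoc, List.cons.injEq, true_and,
        List.append_cancel_left_eq] at hwt
      rwa [hwt]
    · simp [high_eq_cons (hrange B hB).2] at hwt
  · rintro ⟨B, hB, h⟩
    have hw : Letter.dollar :: low (code B) ∈ dict1 n k N G code := Or.inl ⟨B, hB, Or.inl rfl⟩
    simpa [← low_append_high (hrange B hB).1 (hrange B hB).2] using h.append hw

theorem not_inStar_gam_cons
    (hrange : ∀ B : Finset (Fin n), G.IsNClique k B → 1 ≤ code B ∧ code B ≤ N)
    (R : List Letter) : ¬ InStar (dict1 n k N G code) (Letter.gam :: R) := by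
  intro h
  obtain ⟨w, hw, t, hwt, -⟩ := h.exists_append (by simp)
  obtain ⟨B, hB, rfl | ⟨u, rfl, -⟩⟩ := mem_dict1_cases hw
  · simp at hwt
  · simp [high_eq_cons (hrange B hB).2] at hwt

/-- A factorization of a string starting with `High(code B)` begins with a word of `B`. -/
theorem InStar.exists_of_high_append
    (hrange : ∀ B : Finset (Fin n), G.IsNClique k B → 1 ≤ code B ∧ code B ≤ N)
    (hinj : ∀ B C : Finset (Fin n), G.IsNClique k B → G.IsNClique k C → code B = code C → B = C)
    {B : Finset (Fin n)} (hB : G.IsNClique k B) {R : List Letter}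
    (h : InStar (dict1 n k N G code) (high N (code B) ++ R)) :
    ∃ u t, R = u ++ t ∧ InStar (dict1 n k N G code) t ∧
        (u = [Letter.dollar] ∨
         (∃ i : Fin n, i ∉ B ∧ (∀ v ∈ B, G.Adj i v) ∧
           u = Letter.hash :: Letter.num (i.val + 1) :: Letter.hash :: low (code B)) ∨
         ∃ C : Finset (Fin n), G.IsNClique k C ∧ Disjoint B C ∧
           (∀ b ∈ B, ∀ c ∈ C, G.Adj b c) ∧
           u = Letter.dollar :: Letter.gam :: Letter.dollar :: low (code C)) := by
  have hBN := (hrange B hB).2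
  obtain ⟨w, hw, t, hwt, ht⟩ := h.exists_append (by simp [high_eq_cons hBN])
  obtain ⟨B', hB', rfl | ⟨u, rfl, hu⟩⟩ := mem_dict1_cases hw
  · simp [high_eq_cons hBN] at hwt
  · have hcode : code B = code B' := by
      have hwt' := hwt
      simp only [high_eq_cons hBN, high_eq_cons (hrange B' hB').2, List.cons_append,
        List.cons.injEq, Letter.num.injEq] at hwt'
      exact hwt'.1
    obtain rfl := hinj B B' hB hB' hcode
    rw [List.append_assoc, List.append_cancel_left_eq] at hwt
    exact ⟨u, t, hwt, ht, hu⟩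

theorem inStar_high_vertexBlocks_iff
    (hrange : ∀ B : Finset (Fin n), G.IsNClique k B → 1 ≤ code B ∧ code B ≤ N)
    (hinj : ∀ B C : Finset (Fin n), G.IsNClique k B → G.IsNClique k C → code B = code C → B = C)
    {B : Finset (Fin n)} (hB : G.IsNClique k B) (L : List (Fin n)) (T : List Letter) :
    InStar (dict1 n k N G code) (high N (code B) ++ (vertexBlocks N L ++ T)) ↔
      (∀ a ∈ L, a ∉ B ∧ ∀ v ∈ B, G.Adj a v) ∧
        InStar (dict1 n k N G code) (high N (code B) ++ T) := by
  have hfull := low_append_high (hrange B hB).1 (hrange B hB).2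
  induction L with
  | nil => simp [vertexBlocks]
  | cons a L ih =>
    rw [List.forall_mem_cons, and_assoc]
    refine Iff.trans ?_ (and_congr_right' ih)
    have hcons : vertexBlocks N (a :: L) ++ T =
        Letter.hash :: Letter.num (a.val + 1) :: Letter.hash ::
          (low (code B) ++ (high N (code B) ++ (vertexBlocks N L ++ T))) := by
      simp [vertexBlocks, ← hfull]
    rw [hcons]
    constructor
    · intro h
      obtain ⟨u, t, hut, ht, rfl | ⟨i, hi, hadj, rfl⟩ | ⟨C, -, -, -, rfl⟩⟩ :=
        h.exists_of_high_append hrange hinj hB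
      · simp at hut
      · simp only [List.cons_append, List.cons.injEq, Letter.num.injEq, Nat.add_right_cancel_iff,
          true_and, List.append_cancel_left_eq] at hut
        obtain ⟨hai, rfl⟩ := hut
        obtain rfl := Fin.ext hai
        exact ⟨⟨hi, hadj⟩, ht⟩
      · simp at hut
    · rintro ⟨⟨hi, hadj⟩, h⟩
      have hw : high N (code B) ++ Letter.hash :: Letter.num (a.val + 1) :: Letter.hash ::
          low (code B) ∈ dict1 n k N G code :=
        Or.inl ⟨B, hB, Or.inr (Or.inr ⟨a, hi, hadj, rfl⟩)⟩
      simpa using h.append hw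

theorem inStar_high_dollar {B : Finset (Fin n)} (hB : G.IsNClique k B) :
    InStar (dict1 n k N G code) (high N (code B) ++ [Letter.dollar]) :=
  ⟨[high N (code B) ++ [Letter.dollar]],
    List.forall_mem_singleton.2 (Or.inl ⟨B, hB, Or.inr (Or.inl rfl)⟩), by simp⟩

theorem inStar_high_bridge_iff
    (hrange : ∀ B : Finset (Fin n), G.IsNClique k B → 1 ≤ code B ∧ code B ≤ N)
    (hinj : ∀ B C : Finset (Fin n), G.IsNClique k B → G.IsNClique k C → code B = code C → B = C)
    {B : Finset (Fin n)} (hB : G.IsNClique k B) (R : List Letter) :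
    InStar (dict1 n k N G code)
        (high N (code B) ++ Letter.dollar :: Letter.gam :: Letter.dollar :: (full N ++ R)) ↔
      ∃ C, G.IsNClique k C ∧ Disjoint B C ∧ (∀ b ∈ B, ∀ c ∈ C, G.Adj b c) ∧
        InStar (dict1 n k N G code) (high N (code C) ++ R) := by
  constructor
  · intro h
    obtain ⟨u, t, hut, ht, rfl | ⟨i, -, -, rfl⟩ | ⟨C, hC, hd, hadj, rfl⟩⟩ :=
      h.exists_of_high_append hrange hinj hB
    · simp only [List.cons_append, List.nil_append, List.cons.injEq, true_and] at hut
      rw [← hut] at ht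
      exact absurd ht (not_inStar_gam_cons hrange _)
    · simp at hut
    · refine ⟨C, hC, hd, hadj, ?_⟩
      rw [← low_append_high (hrange C hC).1 (hrange C hC).2] at hut
      simp only [List.cons_append, List.append_assoc, List.cons.injEq, true_and,
        List.append_cancel_left_eq] at hut
      rwa [hut]
  · rintro ⟨C, hC, hd, hadj, h⟩
    have hw : high N (code B) ++ Letter.dollar :: Letter.gam :: Letter.dollar :: low (code C) ∈
        dict1 n k N G code := Or.inr ⟨B, C, hB, hC, hd, hadj, rfl⟩
    simpa [← low_append_high (hrange C hC).1 (hrange C hC).2] using h.append hw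

theorem inStar_wordA_gam_wordA_iff
    (hrange : ∀ B : Finset (Fin n), G.IsNClique k B → 1 ≤ code B ∧ code B ≤ N)
    (hinj : ∀ B C : Finset (Fin n), G.IsNClique k B → G.IsNClique k C → code B = code C → B = C)
    (A : Finset (Fin n)) :
    InStar (dict1 n k N G code) (wordA n N A ++ Letter.gam :: wordA n N A) ↔
      ∃ B C, G.IsNClique k B ∧ G.IsNClique k C ∧
        (∀ a ∈ A, a ∉ B ∧ ∀ v ∈ B, G.Adj a v) ∧ (∀ a ∈ A, a ∉ C ∧ ∀ v ∈ C, G.Adj a v) ∧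
        Disjoint B C ∧ ∀ b ∈ B, ∀ c ∈ C, G.Adj b c := by
  have hword : wordA n N A ++ Letter.gam :: wordA n N A =
      Letter.dollar :: (full N ++ (vertexBlocks N (A.sort (· ≤ ·)) ++
        Letter.dollar :: Letter.gam :: Letter.dollar :: (full N ++
          (vertexBlocks N (A.sort (· ≤ ·)) ++ [Letter.dollar])))) := by
    simp [wordA, vertexBlocks]
  rw [hword, inStar_dollar_full_iff hrange]
  constructor
  · rintro ⟨B, hB, h⟩
    rw [inStar_high_vertexBlocks_iff hrange hinj hB, inStar_high_bridge_iff hrange hinj hB] at h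
    obtain ⟨hAB, C, hC, hd, hadj, h⟩ := h
    rw [inStar_high_vertexBlocks_iff hrange hinj hC] at h
    exact ⟨B, C, hB, hC, by simpa using hAB, by simpa using h.1, hd, hadj⟩
  · rintro ⟨B, C, hB, hC, hAB, hAC, hd, hadj⟩
    refine ⟨B, hB, ?_⟩
    rw [inStar_high_vertexBlocks_iff hrange hinj hB, inStar_high_bridge_iff hrange hinj hB]
    refine ⟨by simpa using hAB, C, hC, hd, hadj, ?_⟩
    rw [inStar_high_vertexBlocks_iff hrange hinj hC]
    exact ⟨by simpa using hAC, inStar_high_dollar hC⟩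

end Parsing

theorem stmt6 (k n : ℕ) (hk : 1 ≤ k) (hn : 1 ≤ n)
    (G : SimpleGraph (Fin n)) (code : Finset (Fin n) → ℕ)
    (hcode_range : ∀ B : Finset (Fin n), G.IsNClique k B → 1 ≤ code B ∧ code B ≤ n ^ k)
    (hcode_inj : ∀ B C : Finset (Fin n),
      G.IsNClique k B → G.IsNClique k C → code B = code C → B = C)
    (A : Finset (Fin n)) (hA : G.IsNClique (2 * k) A) :
    InStar (dict1 n k (n ^ k) G code)
        (wordA n (n ^ k) A ++ Letter.gam :: wordA n (n ^ k) A) ↔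
      ∃ B C : Finset (Fin n), G.IsNClique k B ∧ G.IsNClique k C ∧
        Disjoint A B ∧ Disjoint A C ∧ Disjoint B C ∧
        G.IsNClique (4 * k) (A ∪ B ∪ C) := by
  rw [inStar_wordA_gam_wordA_iff hcode_range hcode_inj]
  constructor
  · rintro ⟨B, C, hB, hC, hAB, hAC, hd, hadj⟩
    have hdAB : Disjoint A B := Finset.disjoint_left.2 fun a ha => (hAB a ha).1
    have hdAC : Disjoint A C := Finset.disjoint_left.2 fun a ha => (hAC a ha).1
    refine ⟨B, C, hB, hC, hdAB, hdAC, hd, ?_, ?_⟩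
    · have : Std.Symm G.Adj := ⟨fun _ _ h => h.symm⟩
      rw [Finset.coe_union, Finset.coe_union, SimpleGraph.IsClique,
        Set.pairwise_union_of_symm, Set.pairwise_union_of_symm]
      refine ⟨⟨hA.isClique, hB.isClique, fun a ha b hb _ => (hAB a ha).2 b hb⟩, hC.isClique, ?_⟩
      rintro x (hx | hx) c hc -
      · exact (hAC x hx).2 c hc
      · exact hadj x hx c hc
    · rw [Finset.card_union_of_disjoint (Finset.disjoint_union_left.2 ⟨hdAC, hd⟩),
        Finset.card_union_of_disjoint hdAB, hA.card_eq, hB.card_eq, hC.card_eq]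
      ring
  · rintro ⟨B, C, hB, hC, hdAB, hdAC, hd, hclique, -⟩
    refine ⟨B, C, hB, hC, fun a ha => ⟨Finset.disjoint_left.1 hdAB ha, fun v hv => ?_⟩,
      fun a ha => ⟨Finset.disjoint_left.1 hdAC ha, fun v hv => ?_⟩, hd, fun b hb c hc => ?_⟩
    · exact hclique (by simp [ha]) (by simp [hv]) (Finset.disjoint_iff_ne.1 hdAB a ha v hv)
    · exact hclique (by simp [ha]) (by simp [hv]) (Finset.disjoint_iff_ne.1 hdAC a ha v hv)
    · exact hclique (by simp [hb]) (by simp [hc]) (Finset.disjoint_iff_ne.1 hd b hb c hc)
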